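/- arXiv:2210.15436 — 3 statements merged into one kernel-verified Lean document; each statement's English description precedes it below -/
import Mathlib

section
/- If C is a linear code over a principal ideal ring of length n, rank K, and minimum Hamming distance d, then d \le n - K + 1. -/
open Matrix Finset

/-- The Hamming weight of a vector: number of nonzero entries. -/
noncomputable def wt {R : Type*} [Zero R] {n : ℕ} (v : Fin n → R) : ℕ :=
  Nat.card {i : Fin n // v i ≠ 0}

/-- Minimum Hamming distance (= minimum weight of a nonzero codeword). -/
noncomputable def minDist {R : Type*} [Zero R] {n : ℕ} (C : Set (Fin n → R)) : ℕ :=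
  sInf {w | ∃ c ∈ C, c ≠ 0 ∧ wt c = w}

/-- Dual code w.r.t. the standard inner product. -/
def dualCode {R : Type*} [CommRing R] {n : ℕ} (C : Submodule R (Fin n → R)) :
    Submodule R (Fin n → R) where
  carrier := {v | ∀ c ∈ C, ∑ i, v i * c i = 0}
  add_mem' := by
    intro a b ha hb c hc
    simp only [Set.mem_setOf_eq] at *
    simp [Pi.add_apply, add_mul, Finset.sum_add_distrib, ha c hc, hb c hc]
  zero_mem' := by
    intro c hc
    simp
  smul_mem' := by
    intro r v hv c hc
    simp only [Set.mem_setOf_eq] at *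
    simp [Pi.smul_apply, smul_eq_mul, mul_assoc, ← Finset.mul_sum, hv c hc]

/-- The rank of a code: minimal number of generators. -/
noncomputable def rankCode {R M : Type*} [Ring R] [AddCommGroup M] [Module R M] (C : Submodule R M) : ℕ :=
  sInf {k | ∃ S : Finset M, S.card = k ∧ Submodule.span R (S : Set M) = C}

/-- `H` is a parity-check matrix for `C` : its kernel is exactly `C`. -/
def IsParityCheck {R : Type*} [CommRing R] {m n : ℕ} (H : Matrix (Fin m) (Fin n) R)
    (C : Submodule R (Fin n → R)) : Prop :=
  ∀ v, v ∈ C ↔ H.mulVec v = 0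

/-- A matrix (with rows indexed by `m`, columns by `ι`) has type `(t 0, …, t (s-1))` if exactly
`t i` of its rows are divisible by `γ^i` but not by `γ^(i+1)`. -/
def MatrixType {R : Type*} [CommRing R] {m ι : Type*} (γ : R) (s : ℕ)
    (M : m → ι → R) (t : ℕ → ℕ) : Prop :=
  ∀ i < s, Nat.card {r : m // (∃ u, M r = γ ^ i • u) ∧ ¬ ∃ u, M r = γ ^ (i + 1) • u} = t i

/-- A code has type `(k 0, …, k (s-1))` if it admits a generator matrix (rows span the code,
no row is a combination of the others) of that row type. -/
def CodeHasType {R : Type*} [CommRing R] {n : ℕ} (γ : R) (s : ℕ)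
    (C : Submodule R (Fin n → R)) (k : ℕ → ℕ) : Prop :=
  ∃ G : Matrix (Fin (∑ i ∈ Finset.range s, k i)) (Fin n) R,
    Submodule.span R (Set.range G) = C ∧
    (∀ j, G j ∉ Submodule.span R (Set.range G \ {G j})) ∧
    MatrixType γ s G k

/-- The weight distribution of a code. -/
noncomputable def weightDist {R : Type*} [CommRing R] {n : ℕ} (C : Submodule R (Fin n → R)) (l : ℕ) : ℕ :=
  Nat.card {c : Fin n → R // c ∈ C ∧ wt c = l}

/-- A ring is a chain ring if its ideals are linearly ordered by inclusion. -/
def IsChainRing (R : Type*) [Ring R] : Prop := ∀ I J : Ideal R, I ≤ J ∨ J ≤ I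

/-- `γ` generates the (unique) maximal ideal of `R`. -/
def MaxIdealGen {R : Type*} [CommRing R] (γ : R) : Prop :=
  Ideal.span {γ} ≠ ⊤ ∧ ∀ I : Ideal R, I ≠ ⊤ → I ≤ Ideal.span {γ}

theorem exists_span_of_inj {R M : Type*} [CommRing R] [IsPrincipalIdealRing R]
    [AddCommGroup M] [Module R M] (m : ℕ) : ∀ (N : Submodule R M) (f : M →ₗ[R] (Fin m → R)),
    (∀ x ∈ N, f x = 0 → x = 0) →
    ∃ S : Finset M, S.card ≤ m ∧ Submodule.span R (S : Set M) = N := by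
  classical
  induction m with
  | zero =>
    intro N f hf
    refine ⟨∅, by simp, ?_⟩
    symm
    simp only [Finset.coe_empty, Submodule.span_empty]
    rw [Submodule.eq_bot_iff]
    exact fun x hx => hf x hx (Subsingleton.elim _ _)
  | succ m ih =>
    intro N f hf
    let p : M →ₗ[R] R := (LinearMap.proj 0).comp f
    let g : M →ₗ[R] (Fin m → R) := (LinearMap.funLeft R R Fin.succ).comp f
    have hp : ∀ x, p x = f x 0 := fun _ => rfl
    have hg : ∀ x i, g x i = f x (Fin.succ i) := fun _ _ => rfl
    obtain ⟨S, hS, hspan⟩ := ih (N ⊓ LinearMap.ker p) g (by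
      rintro x ⟨hx, hx0⟩ hgx
      apply hf x hx
      funext i
      refine Fin.cases ?_ (fun j => ?_) i
      · exact hx0
      · exact congrFun hgx j)
    obtain ⟨a, ha⟩ := (IsPrincipalIdealRing.principal (N.map p)).principal
    have ham : a ∈ N.map p := by rw [ha]; exact Submodule.mem_span_singleton_self a
    obtain ⟨x, hx, hxa⟩ := ham
    refine ⟨insert x S, (Finset.card_insert_le _ _).trans (by omega), ?_⟩
    rw [Finset.coe_insert, Submodule.span_insert, hspan]
    apply le_antisymm
    · refine sup_le ?_ inf_le_left
      rw [Submodule.span_singleton_le_iff_mem]; exact hx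
    · intro y hy
      have : p y ∈ N.map p := ⟨y, hy, rfl⟩
      rw [ha, Submodule.mem_span_singleton] at this
      obtain ⟨r, hr⟩ := this
      rw [Submodule.mem_sup]
      refine ⟨r • x, Submodule.smul_mem _ _ (Submodule.mem_span_singleton_self x), y - r • x,
        ⟨N.sub_mem hy (N.smul_mem r hx), ?_⟩, by abel⟩
      change p (y - r • x) = 0
      rw [map_sub, map_smul, hxa, hr, sub_self]

theorem stmt_4 {R : Type*} [CommRing R] [Fintype R] [Nontrivial R]
    [IsPrincipalIdealRing R]
    {n : ℕ} (C : Submodule R (Fin n → R)) (hC : C ≠ ⊥) :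
    minDist (C : Set (Fin n → R)) ≤ n - rankCode C + 1 := by
  classical
  have hwt : ∀ v : Fin n → R, wt v = (Finset.univ.filter (fun i => v i ≠ 0)).card := by
    intro v
    unfold wt
    rw [Nat.card_eq_fintype_card, Fintype.card_subtype]
  have hmin : ∀ c ∈ C, c ≠ 0 → minDist (C : Set (Fin n → R)) ≤ wt c :=
    fun c hc h0 => Nat.sInf_le ⟨c, hc, h0, rfl⟩
  obtain ⟨c, hc, hc0⟩ := Submodule.exists_mem_ne_zero_of_ne_bot hC
  have hdn : minDist (C : Set (Fin n → R)) ≤ n := by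
    refine (hmin c hc hc0).trans ?_
    rw [hwt]
    exact (Finset.card_le_univ _).trans (by simp)
  by_cases hd0 : minDist (C : Set (Fin n → R)) = 0
  · omega
  generalize minDist (C : Set (Fin n → R)) = d at *
  have hm : n - d + 1 ≤ n := by omega
  obtain ⟨S, hS, hspan⟩ := exists_span_of_inj (n - d + 1) C
    (LinearMap.funLeft R R (Fin.castLE hm)) (by
      intro x hx hfx
      by_contra hx0
      have h1 := hmin x hx hx0
      rw [hwt] at h1
      have h3 : (Finset.univ.filter (fun i => x i ≠ 0)) ⊆
          (Finset.univ.image (Fin.castLE hm))ᶜ := by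
        intro i hi
        simp only [Finset.mem_filter, Finset.mem_univ, true_and] at hi
        simp only [Finset.mem_compl, Finset.mem_image, Finset.mem_univ, true_and]
        rintro ⟨j, rfl⟩
        exact hi (congrFun hfx j)
      have h4 := Finset.card_le_card h3
      rw [Finset.card_compl, Finset.card_image_of_injective _ (Fin.castLE_injective hm)] at h4
      simp only [Finset.card_univ, Fintype.card_fin] at h4
      omega)
  have hr : rankCode C ≤ S.card := Nat.sInf_le ⟨S, rfl, hspan⟩
  omega
end

section
/- Let C be a linear code over a finite chain ring of type (k_0, ..., k_{s-1}), rank K = \sum k_i, and free rank k_0, with dual code C^\perp of minimum distance d^\perp, and let H be a parity-check matrix for C in standard form. If n - d^\perp < \nu \le n, then every (n - k_0) \times \nu submatrix of H obtained by selecting \nu columns has type (n-K, k_{s-1}, k_{s-2}, ..., k_1); in particular all such submatrices have rank n - K. -/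
open Matrix Finset

section helpers

variable {R : Type*} [CommRing R]

lemma aux_nonunit {γ : R} (hmax : MaxIdealGen γ) {y : R} (hy : ¬ IsUnit y) : γ ∣ y := by
  have h := hmax.2 (Ideal.span {y}) (by rwa [Ne, Ideal.span_singleton_eq_top])
  exact Ideal.span_singleton_le_span_singleton.1 h

lemma aux_dvd {γ : R} {s : ℕ} (hmax : MaxIdealGen γ) (hnil' : γ ^ (s - 1) ≠ 0)
    (x : R) (i : ℕ) (hi : i ≤ s) (hx : γ ^ (s - i) * x = 0) : γ ^ i ∣ x := by
  induction i with
  | zero => simp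
  | succ j ih =>
    have h1 : γ ^ (s - j) * x = 0 := by
      have : s - j = (s - (j + 1)) + 1 := by omega
      rw [this, pow_succ, mul_comm (γ ^ _) γ, mul_assoc, hx, mul_zero]
    obtain ⟨y, rfl⟩ := ih (by omega) h1
    rw [← mul_assoc, ← pow_add, show s - (j + 1) + j = s - 1 by omega] at hx
    have hy : ¬ IsUnit y := fun hu => hnil' (by simpa using (hu.mul_left_eq_zero).1 hx)
    obtain ⟨z, rfl⟩ := aux_nonunit hmax hy
    exact ⟨z, by ring⟩

lemma aux_vdvd {γ : R} {s : ℕ} (hmax : MaxIdealGen γ) (hnil : γ ^ s = 0) (hnil' : γ ^ (s - 1) ≠ 0)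
    {ι : Type*} (w : ι → R) (i : ℕ) (hi : i ≤ s) :
    (∃ u, w = γ ^ i • u) ↔ γ ^ (s - i) • w = 0 := by
  constructor
  · rintro ⟨u, rfl⟩
    rw [smul_smul, ← pow_add, Nat.sub_add_cancel hi, hnil, zero_smul]
  · intro h
    have : ∀ j, ∃ c, w j = γ ^ i * c := fun j =>
      aux_dvd hmax hnil' (w j) i hi (by simpa using congrFun h j)
    choose u hu using this
    exact ⟨u, funext hu⟩

/-- valuation of a row, capped at s -/
noncomputable def vl (γ : R) (s : ℕ) {ι : Type*} (w : ι → R) : ℕ :=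
  @Nat.findGreatest (fun i => ∃ u, w = γ ^ i • u) (fun _ => Classical.propDecidable _) s

lemma vl_le (γ : R) (s : ℕ) {ι : Type*} (w : ι → R) : vl γ s w ≤ s := by
  classical
  exact Nat.findGreatest_le _

lemma vl_spec (γ : R) (s : ℕ) {ι : Type*} (w : ι → R) : ∃ u, w = γ ^ (vl γ s w) • u := by
  classical
  exact Nat.findGreatest_spec (P := fun i => ∃ u, w = γ ^ i • u) (Nat.zero_le s) ⟨w, by simp⟩

lemma vl_iff (γ : R) (s : ℕ) {ι : Type*} (w : ι → R) (i : ℕ) (hi : i < s) :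
    ((∃ u, w = γ ^ i • u) ∧ ¬ ∃ u, w = γ ^ (i + 1) • u) ↔ vl γ s w = i := by
  classical
  have mono : ∀ a b, a ≤ b → (∃ u, w = γ ^ b • u) → ∃ u, w = γ ^ a • u := by
    rintro a b hab ⟨u, hu⟩
    exact ⟨γ ^ (b - a) • u, by rw [hu, smul_smul, ← pow_add, Nat.add_sub_cancel' hab]⟩
  constructor
  · rintro ⟨h1, h2⟩
    apply le_antisymm
    · by_contra hc
      exact h2 (mono _ _ (by omega) (vl_spec γ s w))
    · exact Nat.le_findGreatest hi.le h1
  · intro h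
    refine ⟨h ▸ vl_spec γ s w, fun h2 => ?_⟩
    have : i + 1 ≤ vl γ s w := Nat.le_findGreatest hi h2
    omega

/-- size of the ideal generated by the i-th power -/
noncomputable def cc (γ : R) (i : ℕ) : ℕ := Nat.card (Ideal.span {γ ^ i} : Ideal R)

lemma cc_zero (γ : R) : cc γ 0 = Nat.card R := by
  unfold cc
  rw [pow_zero, Ideal.span_singleton_one]
  exact Nat.card_congr (Equiv.Set.univ R)

lemma cc_s {γ : R} {s : ℕ} (hnil : γ ^ s = 0) : cc γ s = 1 := by
  unfold cc
  rw [hnil, Ideal.span_singleton_zero]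
  simp

lemma cc_mul [Finite R] {γ : R} {s : ℕ} (hmax : MaxIdealGen γ) (hnil : γ ^ s = 0)
    (hnil' : γ ^ (s - 1) ≠ 0) (i : ℕ) (hi : i ≤ s) : cc γ i * cc γ (s - i) = Nat.card R := by
  let f : R →ₗ[R] R := LinearMap.mulLeft R (γ ^ i)
  have h := Submodule.card_eq_card_quotient_mul_card (LinearMap.ker f)
  have h2 : Nat.card (R ⧸ LinearMap.ker f) = cc γ i := by
    rw [Nat.card_congr f.quotKerEquivRange.toEquiv]
    unfold cc
    have : LinearMap.range f = Ideal.span {γ ^ i} := by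
      ext x
      rw [Ideal.mem_span_singleton]
      constructor
      · rintro ⟨y, rfl⟩; exact ⟨y, rfl⟩
      · rintro ⟨y, rfl⟩; exact ⟨y, rfl⟩
    rw [this]
  have h3 : Nat.card (LinearMap.ker f) = cc γ (s - i) := by
    unfold cc
    have : LinearMap.ker f = Ideal.span {γ ^ (s - i)} := by
      ext x
      rw [Ideal.mem_span_singleton, LinearMap.mem_ker]
      constructor
      · intro hx
        apply aux_dvd hmax hnil' x (s - i) (by omega)
        rw [show s - (s - i) = i by omega]
        exact hx
      · rintro ⟨y, rfl⟩
        change γ ^ i * (γ ^ (s - i) * y) = 0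
        rw [← mul_assoc, ← pow_add, show i + (s - i) = s by omega, hnil, zero_mul]
    rw [this]
  rw [h, h2, h3]
  try ring

lemma type_card {γ : R} {s : ℕ} {m ι : Type*} [Fintype m] {M : m → ι → R} {t : ℕ → ℕ}
    (h : MatrixType γ s M t) (i : ℕ) (hi : i < s) :
    #{r : m | vl γ s (M r) = i} = t i := by
  rw [← h i hi, Nat.card_congr (Equiv.subtypeEquivRight fun r => vl_iff γ s (M r) i hi),
    Nat.card_eq_fintype_card, Fintype.card_subtype]

lemma type_prod {γ : R} {s : ℕ} (hnil : γ ^ s = 0) {m ι : Type*} [Fintype m] {M : m → ι → R}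
    {t : ℕ → ℕ} (h : MatrixType γ s M t) :
    ∏ r, cc γ (vl γ s (M r)) = ∏ i ∈ Finset.range s, cc γ i ^ t i := by
  rw [← Finset.prod_fiberwise_of_maps_to (s := Finset.univ) (t := Finset.range (s + 1))
    (g := fun r => vl γ s (M r)) (fun r _ => Finset.mem_range.2 (Nat.lt_succ_of_le (vl_le _ _ _)))]
  have : ∀ i, ∏ r with vl γ s (M r) = i, cc γ (vl γ s (M r))
      = cc γ i ^ #{r : m | vl γ s (M r) = i} := by
    intro i
    apply Finset.prod_eq_pow_card
    intro r hr
    rw [(Finset.mem_filter.1 hr).2]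
  simp_rw [this]
  rw [Finset.prod_range_succ, cc_s hnil, one_pow, mul_one]
  apply Finset.prod_congr rfl
  intro i hi
  rw [type_card h i (Finset.mem_range.1 hi)]

lemma type_sum {γ : R} {s : ℕ} {m ι : Type*} [Fintype m] {M : m → ι → R}
    {t : ℕ → ℕ} (h : MatrixType γ s M t) :
    ∑ i ∈ Finset.range s, t i ≤ Fintype.card m := by
  classical
  rw [← Finset.sum_congr rfl (fun i hi => type_card h i (Finset.mem_range.1 hi)),
    ← Finset.card_biUnion]
  · exact Finset.card_le_univ _
  · intro a _ b _ hab
    rw [Function.onFun, Finset.disjoint_left]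
    intro r hr hr'
    simp at hr hr'
    omega

lemma span_card [Finite R] {γ : R} {s : ℕ} {m n : ℕ} (G : Matrix (Fin m) (Fin n) R) :
    Nat.card (Submodule.span R (Set.range G)) ≤ ∏ j, cc γ (vl γ s (G j)) := by
  choose u hu using fun j => vl_spec γ s (G j)
  have key : ∀ c : Submodule.span R (Set.range G),
      ∃ x : (∀ j, (Ideal.span {γ ^ (vl γ s (G j))} : Ideal R)), ∑ j, (x j : R) • u j = c := by
    rintro ⟨c, hc⟩
    obtain ⟨a, rfl⟩ := (Submodule.mem_span_range_iff_exists_fun R).1 hc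
    refine ⟨fun j => ⟨a j * γ ^ (vl γ s (G j)), Ideal.mul_mem_left _ _
      (Ideal.mem_span_singleton_self _)⟩, ?_⟩
    apply Finset.sum_congr rfl
    intro j _
    conv_rhs => rw [hu j]
    rw [smul_smul]
  choose x hx using key
  have hinj : Function.Injective x := by
    intro a b hab
    apply Subtype.ext
    rw [← hx a, ← hx b, hab]
  have := Nat.card_le_card_of_injective x hinj
  rwa [Nat.card_pi] at this

/-- A matrix map which is not onto is killed by a nonzero functional. -/
lemma surj_of_indep [Finite R] {γ : R} {s : ℕ} (hs : 0 < s) (hmax : MaxIdealGen γ)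
    (hnil : γ ^ s = 0) (hnil' : γ ^ (s - 1) ≠ 0)
    {U : Type*} [Fintype U] [DecidableEq U] (N : Submodule R (U → R))
    (h : ∀ a : U → R, (∀ v ∈ N, ∑ i, a i * v i = 0) → a = 0) : N = ⊤ := by
  by_contra hN
  obtain ⟨P, hP, hNP⟩ := (eq_top_or_exists_le_coatom N).resolve_left hN
  have hsimp : IsSimpleModule R ((U → R) ⧸ P) := isSimpleModule_iff_isCoatom.2 hP
  obtain ⟨I, hI, ⟨e⟩⟩ := isSimpleModule_iff_quot_maximal.1 hsimp
  have hIle : I ≤ Ideal.span {γ} := hmax.2 I hI.ne_top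
  have hIeq : I = Ideal.span {γ} := hI.eq_of_le hmax.1 hIle
  let f : (R ⧸ I) →ₗ[R] R := Submodule.liftQ I (LinearMap.mulLeft R (γ ^ (s - 1))) (by
    rw [hIeq, Ideal.span, Submodule.span_le, Set.singleton_subset_iff]
    change γ ^ (s - 1) * γ = 0
    rw [← pow_succ, Nat.sub_add_cancel hs, hnil])
  let φ : (U → R) →ₗ[R] R := f ∘ₗ e.toLinearMap ∘ₗ P.mkQ
  have hφ : ∀ v, φ v = ∑ i, φ (Pi.single i 1) * v i := by
    intro v
    conv_lhs => rw [pi_eq_sum_univ' v]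
    rw [map_sum]
    apply Finset.sum_congr rfl
    intro i _
    rw [map_smul, smul_eq_mul, mul_comm]
  have ha := h (fun i => φ (Pi.single i 1)) (by
    intro v hv
    rw [← hφ]
    have : P.mkQ v = 0 := by simpa using hNP hv
    simp [φ, this])
  have hφ0 : ∀ v, φ v = 0 := by
    intro v
    rw [hφ]
    apply Finset.sum_eq_zero
    intro i _
    have := congrFun ha i
    simp only [Pi.zero_apply] at this
    rw [this, zero_mul]
  obtain ⟨v, hv⟩ := P.mkQ_surjective (e.symm (Submodule.Quotient.mk 1))
  apply hnil'
  have h0 := hφ0 v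
  simp only [φ, LinearMap.comp_apply, hv] at h0
  have h1 : f (Submodule.Quotient.mk 1) = 0 := by simpa using h0
  have h2 : f (Submodule.Quotient.mk 1) = γ ^ (s - 1) * 1 := Submodule.liftQ_apply _ _ _
  rw [h1, mul_one] at h2
  exact h2.symm

end helpers

lemma rank_aux {R : Type*} [CommRing R] [Finite R] {γ : R} {s : ℕ} (hs : 0 < s)
    (hmax : MaxIdealGen γ) (hnil : γ ^ s = 0) (hnil' : γ ^ (s - 1) ≠ 0)
    {m ν : ℕ} (A : Matrix (Fin m) (Fin ν) R) (Q : Fin m → Prop) [DecidablePred Q]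
    (h1 : ∀ a : {r // Q r} → R, (∀ j, ∑ r, a r * A r j = 0) → a = 0)
    (h2 : ∀ r, ¬ Q r → ∀ j, γ ∣ A r j) : A.rank = Fintype.card {r // Q r} := by
  have : Nontrivial R := nontrivial_of_ne _ _ hnil'
  let N := LinearMap.range A.mulVecLin
  let π : (Fin m → R) →ₗ[R] ({r // Q r} → R) := LinearMap.funLeft R R Subtype.val
  let πN : N →ₗ[R] ({r // Q r} → R) := π ∘ₗ N.subtype
  have hdiv : ∀ b ∈ N, ∀ r, ¬ Q r → γ ∣ b r := by
    rintro _ ⟨v, rfl⟩ r hr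
    rw [Matrix.mulVecLin_apply, Matrix.mulVec, dotProduct]
    exact Finset.dvd_sum fun j _ => Dvd.dvd.mul_right (h2 r hr j) _
  change Module.finrank R N = _
  apply le_antisymm
  · apply Module.finrank_le_of_rank_le
    apply rank_le
    intro S hS
    have hLI : LinearIndependent R (fun i : S => πN i) := by
      rw [Fintype.linearIndependent_iff] at hS ⊢
      intro a ha
      by_contra hne
      have hex : ∃ e, γ ^ e • a = 0 := ⟨s, by rw [hnil, zero_smul]⟩
      classical
      have hfind := Nat.find_spec hex
      have hpos : Nat.find hex ≠ 0 := by
        intro h0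
        rw [h0, pow_zero, one_smul] at hfind
        exact hne fun i => congrFun hfind i
      have hmin : γ ^ (Nat.find hex - 1) • a ≠ 0 := Nat.find_min hex (by omega)
      have hγ : ∀ i, (γ ^ (Nat.find hex - 1) • a) i * γ = 0 := by
        intro i
        have := congrFun hfind i
        rw [← Nat.succ_pred_eq_of_ne_zero hpos] at this
        simp only [Pi.smul_apply, smul_eq_mul, Pi.zero_apply, Nat.succ_eq_add_one, pow_succ,
          Nat.pred_eq_sub_one] at this ⊢
        linear_combination this
      apply hmin
      funext i
      apply hS (γ ^ (Nat.find hex - 1) • a)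
      apply Subtype.ext
      funext r
      simp only [AddSubmonoidClass.coe_finsetSum, Submodule.coe_smul, Finset.sum_apply,
        Pi.smul_apply, ZeroMemClass.coe_zero, Pi.zero_apply, smul_eq_mul]
      by_cases hr : Q r
      · have := congrFun ha ⟨r, hr⟩
        simp only [πN, π, Finset.sum_apply, Pi.smul_apply, smul_eq_mul, LinearMap.comp_apply,
          LinearMap.funLeft_apply, Submodule.subtype_apply, Pi.zero_apply] at this
        simp_rw [mul_assoc]
        rw [← Finset.mul_sum, this, mul_zero]
      · apply Finset.sum_eq_zero
        intro i _
        obtain ⟨c, hc⟩ := hdiv _ i.1.2 r hr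
        rw [hc, ← mul_assoc]
        have := hγ i
        simp only [Pi.smul_apply, smul_eq_mul] at this
        rw [this, zero_mul]
    have := hLI.fintype_card_le_finrank
    rw [Module.finrank_fintype_fun_eq_card] at this
    simpa using this
  · have hsurj : LinearMap.range πN = ⊤ := by
      apply surj_of_indep hs hmax hnil hnil'
      intro a ha
      apply h1
      intro j
      have := ha (πN ⟨A.mulVecLin (Pi.single j 1), ⟨_, rfl⟩⟩) ⟨_, rfl⟩
      simpa [πN, π, LinearMap.funLeft_apply] using this
    obtain ⟨σ, hσ⟩ := LinearMap.exists_rightInverse_of_surjective πN hsurj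
    have hinj : Function.Injective σ := by
      apply Function.LeftInverse.injective (g := πN)
      intro x
      exact LinearMap.congr_fun hσ x
    have := LinearMap.finrank_le_finrank_of_injective hinj
    rwa [Module.finrank_fintype_fun_eq_card] at this

lemma restrict_inj {R : Type*} [CommRing R] {n ν : ℕ} (D : Submodule R (Fin n → R))
    (hν1 : n - minDist (D : Set (Fin n → R)) < ν) (hν2 : ν ≤ n)
    (g : Fin ν → Fin n) (hg : Function.Injective g) (w : Fin n → R) (hw : w ∈ D)
    (h0 : ∀ j, w (g j) = 0) : w = 0 := by
  classical
  by_contra hne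
  have h1 : minDist (D : Set (Fin n → R)) ≤ wt w := Nat.sInf_le ⟨w, hw, hne, rfl⟩
  have h2 : wt w ≤ n - ν := by
    unfold wt
    rw [Nat.card_eq_fintype_card, Fintype.card_subtype]
    have : (Finset.univ.filter fun i => w i ≠ 0) ⊆ (Finset.univ.image g)ᶜ := by
      intro i hi
      simp only [Finset.mem_filter, Finset.mem_compl, Finset.mem_image] at hi ⊢
      rintro ⟨j, _, rfl⟩
      exact hi.2 (h0 j)
    calc _ ≤ _ := Finset.card_le_card this
      _ = _ := by rw [Finset.card_compl, Finset.card_image_of_injective _ hg]; simp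
  omega

/-- Counting forces the parity-check map onto the box of its row valuations. -/
lemma onto_box {R : Type*} [CommRing R] [Finite R] {γ : R} {s : ℕ} (hs : 0 < s)
    (hmax : MaxIdealGen γ) (hnil : γ ^ s = 0) (hnil' : γ ^ (s - 1) ≠ 0)
    {n : ℕ} (C : Submodule R (Fin n → R)) (k : ℕ → ℕ) (htype : CodeHasType γ s C k)
    (K : ℕ) (hK : K = ∑ i ∈ Finset.range s, k i) (hKn : K ≤ n)
    (H : Matrix (Fin (n - k 0)) (Fin n) R) (hH : IsParityCheck H C)
    (hHtype : MatrixType γ s H (fun i => if i = 0 then n - K else k (s - i)))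
    (y : Fin (n - k 0) → R) (hy : ∀ r, γ ^ (vl γ s (H r)) ∣ y r) : ∃ v, H.mulVec v = y := by
  obtain ⟨G, hG, -, hGt⟩ := htype
  have hC : Nat.card C ≤ ∏ i ∈ Finset.range s, cc γ i ^ k i := by
    rw [← type_prod hnil hGt, ← hG]
    exact span_card G
  let B : Submodule R (Fin (n - k 0) → R) :=
    Submodule.pi Set.univ fun r => (Ideal.span {γ ^ (vl γ s (H r))} : Ideal R)
  have hBc : Nat.card B = ∏ r, cc γ (vl γ s (H r)) := by
    unfold cc
    rw [← Nat.card_pi]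
    exact Nat.card_congr
      { toFun := fun b r => ⟨b.1 r, b.2 r trivial⟩
        invFun := fun x => ⟨fun r => x r, fun r _ => (x r).2⟩
        left_inv := fun _ => rfl
        right_inv := fun _ => rfl }
  rw [type_prod hnil hHtype] at hBc
  let T := H.mulVecLin
  have hker : LinearMap.ker T = C := by
    ext v
    rw [hH v]
    rfl
  have hle : LinearMap.range T ≤ B := by
    rintro _ ⟨v, rfl⟩ r _
    obtain ⟨u, hu⟩ := vl_spec γ s (H r)
    rw [SetLike.mem_coe, Ideal.mem_span_singleton]
    change _ ∣ ∑ j, H r j * v j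
    apply Finset.dvd_sum
    intro j _
    rw [congrFun hu j]
    exact Dvd.dvd.mul_right (Dvd.intro _ rfl) _
  have hcard : Nat.card C * Nat.card (LinearMap.range T) = Nat.card R ^ n := by
    have := Submodule.card_eq_card_quotient_mul_card (LinearMap.ker T)
    rw [Nat.card_congr T.quotKerEquivRange.toEquiv, hker, Nat.card_fun] at this
    simpa using this.symm
  have hprod : (∏ i ∈ Finset.range s, cc γ i ^ k i) *
      (∏ i ∈ Finset.range s, cc γ i ^ (if i = 0 then n - K else k (s - i))) = Nat.card R ^ n := by
    obtain ⟨q, rfl⟩ : ∃ q, s = q + 1 := ⟨s - 1, by omega⟩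
    have e1 : ∏ i ∈ Finset.range q, cc γ (i + 1) ^ k (q + 1 - (i + 1))
        = ∏ i ∈ Finset.range q, cc γ (q + 1 - (i + 1)) ^ k (i + 1) := by
      rw [← Finset.prod_range_reflect]
      apply Finset.prod_congr rfl
      intro i hi
      have := Finset.mem_range.1 hi
      congr 2 <;> omega
    have hsum : n = n - K + k 0 + ∑ i ∈ Finset.range q, k (i + 1) := by
      rw [Finset.sum_range_succ'] at hK
      omega
    rw [Finset.prod_range_succ', Finset.prod_range_succ']
    simp only [Nat.add_eq_zero_iff, one_ne_zero, and_false, if_false, if_true]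
    rw [e1]
    conv_rhs => rw [hsum]
    rw [pow_add, pow_add, ← Finset.prod_pow_eq_pow_sum, ← cc_zero γ]
    have e2 : ∏ i ∈ Finset.range q, cc γ 0 ^ k (i + 1)
        = (∏ i ∈ Finset.range q, cc γ (i + 1) ^ k (i + 1)) *
          ∏ i ∈ Finset.range q, cc γ (q + 1 - (i + 1)) ^ k (i + 1) := by
      rw [← Finset.prod_mul_distrib]
      apply Finset.prod_congr rfl
      intro i hi
      have := Finset.mem_range.1 hi
      rw [← mul_pow, cc_mul hmax hnil hnil' (i + 1) (by omega), cc_zero]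
    rw [e2]
    ring
  have hge : Nat.card B ≤ Nat.card (LinearMap.range T) := by
    rw [hBc]
    have hpos : 0 < Nat.card C := Nat.card_pos
    rw [← hcard] at hprod
    by_contra hlt
    push Not at hlt
    have := Nat.mul_lt_mul_of_le_of_lt hC hlt (hpos.trans_le hC)
    omega
  have heq : (LinearMap.range T : Set (Fin (n - k 0) → R)) = B :=
    Set.eq_of_subset_of_ncard_le hle hge (Set.toFinite _)
  have hyB : y ∈ (B : Set (Fin (n - k 0) → R)) := fun r _ => Ideal.mem_span_singleton.2 (hy r)
  rw [← heq] at hyB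
  exact hyB

theorem stmt_5 {R : Type*} [CommRing R] [Fintype R] (hR : IsChainRing R)
    (γ : R) (s p : ℕ) (hmax : MaxIdealGen γ) (hnil : γ ^ s = 0) (hnil' : γ ^ (s - 1) ≠ 0)
    (hp : Nat.card (R ⧸ Ideal.span {γ}) = p) (hs : 0 < s)
    {n : ℕ} (C : Submodule R (Fin n → R)) (k : ℕ → ℕ) (htype : CodeHasType γ s C k)
    (K : ℕ) (hK : K = ∑ i ∈ Finset.range s, k i)
    (H : Matrix (Fin (n - k 0)) (Fin n) R) (hH : IsParityCheck H C)
    (hHtype : MatrixType γ s H (fun i => if i = 0 then n - K else k (s - i)))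
    (ν : ℕ) (hν1 : n - minDist (dualCode C : Set (Fin n → R)) < ν) (hν2 : ν ≤ n)
    (g : Fin ν → Fin n) (hg : Function.Injective g) :
    MatrixType γ s (fun r j => H r (g j)) (fun i => if i = 0 then n - K else k (s - i)) ∧
    (Matrix.of fun r j => H r (g j)).rank = n - K := by  classical
  have hrow : ∀ r, H r ∈ dualCode C := by
    intro r c hc
    exact congrFun ((hH c).1 hc) r
  have hinj := restrict_inj (dualCode C) hν1 hν2 g hg
  have hdiv : ∀ r i, i ≤ s → ((∃ u, (fun j => H r (g j)) = γ ^ i • u) ↔ ∃ u, H r = γ ^ i • u) := by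
    intro r i hi
    rw [aux_vdvd hmax hnil hnil' _ i hi, aux_vdvd hmax hnil hnil' _ i hi]
    constructor
    · intro h
      exact hinj _ (Submodule.smul_mem _ _ (hrow r)) fun j => congrFun h j
    · intro h
      funext j
      exact congrFun h (g j)
  refine ⟨?_, ?_⟩
  · intro i hi
    rw [← hHtype i hi]
    apply Nat.card_congr
    apply Equiv.subtypeEquivRight
    intro r
    rw [hdiv r i hi.le, hdiv r (i + 1) hi]
  have hKn : K ≤ n := by
    by_contra hlt
    have h1 := type_sum hHtype
    obtain ⟨q, rfl⟩ : ∃ q, s = q + 1 := ⟨s - 1, by omega⟩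
    have e1 : ∑ i ∈ Finset.range q, k (q + 1 - (i + 1)) = ∑ i ∈ Finset.range q, k (i + 1) := by
      rw [← Finset.sum_range_reflect]
      apply Finset.sum_congr rfl
      intro i hi
      have := Finset.mem_range.1 hi
      congr 1; omega
    rw [Finset.sum_range_succ'] at h1 hK
    simp only [Nat.add_eq_zero_iff, one_ne_zero, and_false, if_false, if_true, Fintype.card_fin] at h1
    rw [e1] at h1
    have hk0 : n < k 0 := by omega
    have hdual : ∀ w ∈ dualCode C, w = 0 := by
      intro w hw
      funext i
      have hmem : (Pi.single i 1 : Fin n → R) ∈ C := by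
        rw [hH]
        funext r
        exact absurd r.2 (by omega)
      simpa [Pi.single_apply] using hw _ hmem
    have : minDist (dualCode C : Set (Fin n → R)) = 0 := by
      unfold minDist
      rw [Nat.sInf_eq_zero]
      right
      ext w
      simp only [Set.mem_empty_iff_false, iff_false]
      rintro ⟨c, hc, hc0, -⟩
      exact hc0 (hdual c hc)
    omega
  have hbox := onto_box hs hmax hnil hnil' C k htype K hK hKn H hH hHtype
  rw [rank_aux hs hmax hnil hnil' _ (fun r => vl γ s (H r) = 0)]
  · have := type_card hHtype 0 hs
    simpa [Fintype.card_subtype] using this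
  · intro a ha
    have hz : ∑ r, a r • H r = 0 := by
      apply hinj
      · exact Submodule.sum_mem _ fun r _ => Submodule.smul_mem _ _ (hrow r)
      · intro j
        simpa [Finset.sum_apply] using ha j
    funext r
    obtain ⟨v, hv⟩ := hbox (Pi.single r.1 1) (by
      intro r'
      by_cases h : r' = r.1
      · rw [h, r.2, pow_zero]; exact one_dvd _
      · rw [Pi.single_eq_of_ne h]; exact dvd_zero _)
    have h3 : ∑ r', a r' * (H.mulVec v) r' = 0 := by
      have : ∀ r' : {r // vl γ s (H r) = 0}, a r' * (H.mulVec v) r' = (a r' • H r') ⬝ᵥ v := by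
        intro r'
        rw [smul_dotProduct]; rfl
      simp_rw [this]
      rw [← sum_dotProduct, hz, zero_dotProduct]
    rw [hv, Finset.sum_eq_single r] at h3
    · simpa using h3
    · intro b _ hb
      rw [Pi.single_eq_of_ne (fun h => hb (Subtype.ext h)), mul_zero]
    · simp
  · intro r hr j
    obtain ⟨u, hu⟩ := vl_spec γ s (H r)
    change γ ∣ H r (g j)
    rw [congrFun hu (g j)]
    exact Dvd.dvd.mul_right (dvd_pow_self γ hr) _
end

section
/- Let C be a linear code of length n over a finite chain ring R with p^s elements, of type (k_0, ..., k_{s-1}) and rank K, with weight distribution (A_0, ..., A_n), where A_l is the number of codewords of Hamming weight l. Let d^\perp be the minimum distance of the dual code. Then for every \nu with n - d^\perp < \nu \le n, \sum_{l=0}^{\nu} \binom{n-l}{\nu-l} A_l = \binom{n}{\nu} |C| / p^{s(n-\nu)}. -/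
open Matrix Finset

theorem superset_count {n : ℕ} (A : Finset (Fin n)) (ν : ℕ) :
    #{T ∈ powersetCard ν (univ : Finset (Fin n)) | A ⊆ T}
      = if #A ≤ ν then (n - #A).choose (ν - #A) else 0 := by
  classical
  split_ifs with h
  · have : n - #A = #(Aᶜ) := by simp [card_compl]
    rw [this, ← card_powersetCard]
    refine card_bij' (fun T _ => T \ A) (fun U _ => U ∪ A) ?_ ?_ ?_ ?_
    · intro T hT
      simp only [mem_filter, mem_powersetCard, subset_univ, true_and] at hT ⊢
      refine ⟨fun x hx => by simp at hx ⊢; exact hx.2, ?_⟩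
      rw [card_sdiff_of_subset hT.2, hT.1]
    · intro U hU
      simp only [mem_filter, mem_powersetCard, subset_univ, true_and] at hU ⊢
      refine ⟨?_, subset_union_right⟩
      rw [card_union_of_disjoint (disjoint_left.2 fun x hx => by simpa using hU.1 hx), hU.2]
      omega
    · intro T hT
      simp only [mem_filter] at hT
      exact sdiff_union_of_subset hT.2
    · intro U hU
      simp only [mem_powersetCard] at hU
      exact union_sdiff_cancel_right (disjoint_left.2 fun x hx => by simpa using hU.1 hx)
  · rw [card_eq_zero, filter_eq_empty_iff]
    intro T hT hA
    rw [mem_powersetCard] at hT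
    exact h (hT.2 ▸ card_le_card hA)

theorem unit_of_not_mem {R : Type*} [CommRing R] {γ : R} (hmax : MaxIdealGen γ) {x : R}
    (hx : x ∉ Ideal.span {γ}) : IsUnit x := by
  by_contra h
  apply hx
  refine hmax.2 (Ideal.span {x}) ?_ (Ideal.mem_span_singleton_self x)
  rwa [Ne, Ideal.span_singleton_eq_top]

theorem card_step {R : Type*} [CommRing R] [Fintype R]
    (γ : R) (hmax : MaxIdealGen γ) (i : ℕ) (hi : γ ^ i ≠ 0) :
    Nat.card (Ideal.span {γ ^ i} : Ideal R) =
      Nat.card (R ⧸ Ideal.span {γ}) * Nat.card (Ideal.span {γ ^ (i+1)} : Ideal R) := by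
  let I : Ideal R := Ideal.span {γ ^ i}
  let J : Ideal R := Ideal.span {γ ^ (i+1)}
  have hJI : J ≤ I := Ideal.span_singleton_le_span_singleton.2 (pow_dvd_pow _ (Nat.le_succ _))
  let N : Submodule R I := Submodule.comap I.subtype J
  let g : R →ₗ[R] I := LinearMap.toSpanSingleton R I ⟨γ ^ i, Ideal.mem_span_singleton_self _⟩
  have hg : ∀ x, (g x : R) = x * γ ^ i := fun x => rfl
  let g' := N.mkQ ∘ₗ g
  have hsurj : Function.Surjective g' := by
    refine (Submodule.mkQ_surjective N).comp ?_
    rintro ⟨y, hy⟩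
    obtain ⟨x, hx⟩ := Ideal.mem_span_singleton'.1 hy
    exact ⟨x, Subtype.ext hx⟩
  have hker : LinearMap.ker g' = Ideal.span {γ} := by
    ext x
    have : x ∈ LinearMap.ker g' ↔ x * γ ^ i ∈ J := by
      rw [LinearMap.mem_ker]
      change N.mkQ (g x) = 0 ↔ _
      rw [Submodule.mkQ_apply, Submodule.Quotient.mk_eq_zero]
      rfl
    rw [this]
    constructor
    · intro h
      by_contra hx
      obtain ⟨y, hy⟩ := Ideal.mem_span_singleton'.1 h
      have hu : IsUnit (x - y * γ) := by
        apply unit_of_not_mem hmax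
        intro h2
        apply hx
        have := Ideal.add_mem _ h2 (Ideal.mul_mem_left _ y (Ideal.mem_span_singleton_self γ))
        simpa using this
      apply hi
      rw [← hu.mul_right_eq_zero, sub_mul, ← hy]
      ring
    · intro h
      obtain ⟨y, rfl⟩ := Ideal.mem_span_singleton'.1 h
      exact Ideal.mem_span_singleton'.2 ⟨y, by ring⟩
  have h1 : Nat.card (I ⧸ N) = Nat.card (R ⧸ Ideal.span {γ}) := by
    rw [← hker]
    exact Nat.card_congr (g'.quotKerEquivOfSurjective hsurj).symm.toEquiv
  have h2 : Nat.card N = Nat.card J :=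
    Nat.card_congr (Submodule.comapSubtypeEquivOfLe hJI).toEquiv
  have h3 := Submodule.card_eq_card_quotient_mul_card N
  change Nat.card I = _ * Nat.card J
  rw [h3, h1, h2, mul_comm]

theorem card_ring {R : Type*} [CommRing R] [Fintype R]
    (γ : R) (s : ℕ) (hmax : MaxIdealGen γ) (hnil : γ ^ s = 0) (hnil' : γ ^ (s - 1) ≠ 0)
    (hs : 0 < s) : Nat.card R = Nat.card (R ⧸ Ideal.span {γ}) ^ s := by
  have key : ∀ i, i ≤ s → Nat.card R =
      Nat.card (R ⧸ Ideal.span {γ}) ^ i * Nat.card (Ideal.span {γ ^ i} : Ideal R) := by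
    intro i
    induction i with
    | zero =>
      intro _
      have : (Ideal.span {γ ^ 0} : Ideal R) = ⊤ := by simp
      rw [this, pow_zero, one_mul]
      exact Nat.card_congr (Submodule.topEquiv (R := R) (M := R)).symm.toEquiv
    | succ i ih =>
      intro hi
      rw [ih (by omega), card_step γ hmax i, ← mul_assoc, ← pow_succ]
      intro h0
      exact hnil' (pow_eq_zero_of_le (by omega) h0)
  rw [key s le_rfl, hnil]
  simp

theorem exists_annihilator {R : Type*} [CommRing R] [Fintype R]
    (γ : R) (s : ℕ) (hmax : MaxIdealGen γ) (hnil : γ ^ s = 0) (hnil' : γ ^ (s - 1) ≠ 0)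
    (hs : 0 < s) {ι : Type*} [Fintype ι] (D : Submodule R (ι → R)) (hD : D ≠ ⊤) :
    ∃ v : ι → R, v ≠ 0 ∧ ∀ c ∈ D, ∑ i, v i * c i = 0 := by
  classical
  obtain ⟨M, hM, hDM⟩ := (eq_top_or_exists_le_coatom D).resolve_left hD
  have hsimple : IsSimpleModule R ((ι → R) ⧸ M) := isSimpleModule_iff_isCoatom.2 hM
  obtain ⟨I, hI, ⟨e⟩⟩ := isSimpleModule_iff_quot_maximal.1 hsimple
  have hIγ : I = Ideal.span {γ} :=
    hI.eq_of_le hmax.1 (hmax.2 I hI.ne_top)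
  let f : (ι → R) →ₗ[R] R ⧸ I := e.toLinearMap ∘ₗ M.mkQ
  choose v hv using fun i => Ideal.Quotient.mk_surjective (I := I) (f (Pi.single i 1))
  have hf : ∀ c, f c = Ideal.Quotient.mk I (∑ i, v i * c i) := by
    intro c
    rw [map_sum]
    conv_lhs => rw [pi_eq_sum_univ' c]
    rw [map_sum]
    refine Finset.sum_congr rfl fun i _ => ?_
    rw [map_mul, hv, map_smul, mul_comm]
    rw [Algebra.smul_def]
    congr 2
  refine ⟨fun i => γ ^ (s-1) * v i, ?_, ?_⟩
  · intro h0
    apply hM.1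
    rw [eq_top_iff]
    intro c _
    have hvi : ∀ i, v i ∈ I := by
      intro i
      by_contra hi
      rw [hIγ] at hi
      have := congrFun h0 i
      simp only [Pi.zero_apply] at this
      exact hnil' (((unit_of_not_mem hmax hi).mul_left_eq_zero).1 this)
    have : f c = 0 := by
      rw [hf, Ideal.Quotient.eq_zero_iff_mem]
      exact Ideal.sum_mem _ fun i _ => Ideal.mul_mem_right _ _ (hvi i)
    have h2 : M.mkQ c = 0 := e.map_eq_zero_iff.1 this
    rwa [Submodule.mkQ_apply, Submodule.Quotient.mk_eq_zero] at h2
  · intro c hc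
    have h2 : M.mkQ c = 0 := by
      rw [Submodule.mkQ_apply, Submodule.Quotient.mk_eq_zero]
      exact hDM hc
    have : f c = 0 := by
      change e (M.mkQ c) = 0
      rw [h2, map_zero]
    rw [hf, Ideal.Quotient.eq_zero_iff_mem, hIγ] at this
    obtain ⟨y, hy⟩ := Ideal.mem_span_singleton'.1 this
    simp_rw [mul_assoc]
    rw [← Finset.mul_sum, ← hy]
    have : γ ^ (s-1) * (y * γ) = y * γ ^ s := by
      conv_rhs => rw [show s = (s - 1) + 1 by omega]
      ring
    rw [this, hnil, mul_zero]

theorem card_shortened {R : Type*} [CommRing R] [Fintype R]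
    (γ : R) (s : ℕ) (hmax : MaxIdealGen γ) (hnil : γ ^ s = 0) (hnil' : γ ^ (s - 1) ≠ 0)
    (hs : 0 < s) {n : ℕ} (C : Submodule R (Fin n → R)) (T : Finset (Fin n))
    (hT : n < #T + minDist (dualCode C : Set (Fin n → R))) :
    Nat.card {c : C // ∀ i ∉ T, c.1 i = 0} * Nat.card R ^ (n - #T) = Nat.card C := by
  classical
  let π : (Fin n → R) →ₗ[R] ({i // i ∉ T} → R) := LinearMap.funLeft R R Subtype.val
  let g : C →ₗ[R] ({i // i ∉ T} → R) := π ∘ₗ C.subtype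
  have hsurj : LinearMap.range g = ⊤ := by
    by_contra hne
    obtain ⟨v, hv0, hv⟩ := exists_annihilator γ s hmax hnil hnil' hs _ hne
    let w : Fin n → R := fun i => if h : i ∉ T then v ⟨i, h⟩ else 0
    have hw0 : w ≠ 0 := by
      intro h0
      apply hv0
      ext ⟨i, hi⟩
      have := congrFun h0 i
      simpa [w, hi] using this
    have hwC : w ∈ dualCode C := by
      intro c hc
      rw [← hv (g ⟨c, hc⟩) ⟨_, rfl⟩]
      symm
      have h1 : ∑ i : {i // i ∉ T}, w i.1 * c i.1 = ∑ i with i ∉ T, w i * c i := by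
        rw [Finset.sum_subtype (p := fun i => i ∉ T)]
        simp
      have h2 : ∑ i with i ∉ T, w i * c i = ∑ i, w i * c i := by
        rw [Finset.sum_filter]
        refine Finset.sum_congr rfl fun i _ => ?_
        by_cases hi : i ∈ T <;> simp [w, hi]
      rw [← h2, ← h1]
      refine Finset.sum_congr rfl fun i _ => ?_
      obtain ⟨i, hi⟩ := i
      simp [w, hi, g, π, LinearMap.funLeft_apply]
    have hle : minDist (dualCode C : Set (Fin n → R)) ≤ wt w :=
      Nat.sInf_le ⟨w, hwC, hw0, rfl⟩
    have hwt : wt w ≤ #(Tᶜ) := by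
      unfold wt
      rw [Nat.card_eq_fintype_card, Fintype.card_subtype]
      apply card_le_card
      intro i hi
      simp only [mem_filter, mem_univ, true_and, mem_compl] at hi ⊢
      intro hiT
      exact hi (by simp [w, hiT])
    rw [card_compl, Fintype.card_fin] at hwt
    have := card_le_univ T
    rw [Fintype.card_fin] at this
    omega
  have hk := Submodule.card_eq_card_quotient_mul_card (LinearMap.ker g)
  have h1 : Nat.card (C ⧸ LinearMap.ker g) = Nat.card R ^ (n - #T) := by
    rw [Nat.card_congr (g.quotKerEquivOfSurjective (LinearMap.range_eq_top.1 hsurj)).toEquiv,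
      Nat.card_fun]
    congr 1
    rw [Nat.card_eq_fintype_card, Fintype.card_subtype_compl]
    simp
  have h2 : Nat.card (LinearMap.ker g) = Nat.card {c : C // ∀ i ∉ T, c.1 i = 0} := by
    refine Nat.card_congr (Equiv.subtypeEquivRight fun c => ?_)
    rw [LinearMap.mem_ker]
    constructor
    · intro h i hi
      exact congrFun h ⟨i, hi⟩
    · intro h
      ext ⟨i, hi⟩
      exact h i hi
  rw [hk, h1, h2]

theorem double_count {R : Type*} [CommRing R] [Fintype R] {n : ℕ}
    (C : Submodule R (Fin n → R)) (ν : ℕ) :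
    ∑ l ∈ Finset.range (ν + 1), (n - l).choose (ν - l) * weightDist C l
      = ∑ T ∈ powersetCard ν (univ : Finset (Fin n)),
          Nat.card {c : C // ∀ i ∉ T, c.1 i = 0} := by
  classical
  have hwt : ∀ c : Fin n → R, wt c = #{i | c i ≠ 0} := by
    intro c
    unfold wt
    rw [Nat.card_eq_fintype_card, Fintype.card_subtype]
  have hA : ∀ l, weightDist C l = #{c : C | wt c.1 = l} := by
    intro l
    unfold weightDist
    rw [← Fintype.card_subtype, ← Nat.card_eq_fintype_card]
    exact Nat.card_congr (Equiv.subtypeSubtypeEquivSubtypeInter (fun c => c ∈ C)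
      (fun c => wt c = l)).symm
  have hT : ∀ T : Finset (Fin n), Nat.card {c : C // ∀ i ∉ T, c.1 i = 0}
      = ∑ c : C, if ({i | c.1 i ≠ 0} : Finset (Fin n)) ⊆ T then 1 else 0 := by
    intro T
    rw [← card_filter, Nat.card_eq_fintype_card, Fintype.card_subtype]
    congr 1
    ext c
    simp only [mem_filter, mem_univ, true_and, subset_iff]
    exact forall_congr' fun i => not_imp_comm
  simp_rw [hT, hA]
  rw [sum_comm]
  simp_rw [← card_filter, superset_count, ← hwt]
  simp_rw [card_filter, mul_sum]
  rw [sum_comm]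
  refine sum_congr rfl fun c _ => ?_
  simp [Finset.sum_ite_eq, Nat.lt_succ_iff]

theorem stmt_6 {R : Type*} [CommRing R] [Fintype R] (hR : IsChainRing R)
    (γ : R) (s p : ℕ) (hmax : MaxIdealGen γ) (hnil : γ ^ s = 0) (hnil' : γ ^ (s - 1) ≠ 0)
    (hp : Nat.card (R ⧸ Ideal.span {γ}) = p) (hs : 0 < s)
    {n : ℕ} (C : Submodule R (Fin n → R)) (k : ℕ → ℕ) (htype : CodeHasType γ s C k)
    (K : ℕ) (hK : K = ∑ i ∈ Finset.range s, k i)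
    (ν : ℕ) (hν1 : n - minDist (dualCode C : Set (Fin n → R)) < ν) (hν2 : ν ≤ n) :
    (∑ l ∈ Finset.range (ν + 1), (n - l).choose (ν - l) * weightDist C l) * p ^ (s * (n - ν))
      = n.choose ν * Nat.card C := by
  rw [double_count, sum_mul]
  have hcard := card_ring γ s hmax hnil hnil' hs
  rw [hp] at hcard
  rw [pow_mul, ← hcard]
  rw [sum_congr rfl (g := fun _ => Nat.card C)]
  · simp
  · intro T hT
    have hT2 := (mem_powersetCard.1 hT).2
    rw [← hT2]
    exact card_shortened γ s hmax hnil hnil' hs C T (by omega)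
end
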